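/- Let X → S be a surjective morphism of irreducible projective varieties with dim S ≥ 1. Then every injective morphism X → ℙ^s satisfies s ≥ 2·dim X − dim S. -/

import Mathlib

open AlgebraicGeometry CategoryTheory MvPolynomial

attribute [local instance] MvPolynomial.gradedAlgebra

/-- Projective `n`-space over `ℂ` as a scheme. -/
noncomputable def ProjSpace (n : ℕ) : Scheme :=
  Proj (homogeneousSubmodule (Fin (n + 1)) ℂ)

/-- The structure morphism `ℙⁿ_ℂ ⟶ Spec ℂ`. -/
noncomputable def ProjSpace.structMor (n : ℕ) :
    ProjSpace n ⟶ Spec (CommRingCat.of ℂ) :=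
  Proj.toSpecZero (homogeneousSubmodule (Fin (n + 1)) ℂ) ≫
    Spec.map (CommRingCat.ofHom
      ((GradedRing.projZeroRingHom' (homogeneousSubmodule (Fin (n + 1)) ℂ)).comp
        (C : ℂ →+* MvPolynomial (Fin (n + 1)) ℂ)))

open TensorProduct TopologicalSpace Topology

theorem Ideal.exists_isMaximal_le_notMem {A : Type*} [CommRing A] [IsJacobsonRing A] {h : A}
    {Q : Ideal A} [Q.IsPrime] (hh : h ∉ Q) : ∃ M : Ideal A, M.IsMaximal ∧ Q ≤ M ∧ h ∉ M := by
  rw [← IsJacobsonRing.out ‹_› (Ideal.IsPrime.isRadical ‹Q.IsPrime›), Ideal.jacobson,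
    Submodule.mem_sInf] at hh
  push Not at hh
  obtain ⟨M, ⟨hQM, hM⟩, hhM⟩ := hh
  exact ⟨M, hM, hQM, hhM⟩

theorem exists_algHom_ne_zero (k A : Type*) [Field k] [IsAlgClosed k] [CommRing A] [IsDomain A]
    [Algebra k A] [Algebra.FiniteType k A] {a : A} (ha : a ≠ 0) : ∃ ε : A →ₐ[k] k, ε a ≠ 0 := by
  have : IsJacobsonRing A := isJacobsonRing_of_finiteType (A := k)
  obtain ⟨M, hM, -, haM⟩ := Ideal.exists_isMaximal_le_notMem (Q := (⊥ : Ideal A)) (h := a)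
    (by simpa using ha)
  let : Field (A ⧸ M) := Ideal.Quotient.field M
  have : Module.Finite k (A ⧸ M) := finite_of_finite_type_of_isJacobsonRing k (A ⧸ M)
  let e : k ≃ₐ[k] A ⧸ M := AlgEquiv.ofBijective (Algebra.ofId k (A ⧸ M))
    IsAlgClosed.algebraMap_bijective_of_isIntegral
  refine ⟨(e.symm : A ⧸ M →ₐ[k] k).comp (Ideal.Quotient.mkₐ k M), ?_⟩
  simpa [Ideal.Quotient.eq_zero_iff_mem] using haM

theorem isDomain_tensorProduct_of_isAlgClosed (k A B : Type*) [Field k] [IsAlgClosed k]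
    [CommRing A] [IsDomain A] [Algebra k A] [Algebra.FiniteType k A]
    [CommRing B] [IsDomain B] [Algebra k B] : IsDomain (A ⊗[k] B) := by
  have : Nontrivial (A ⊗[k] B) := inferInstance
  have : NoZeroDivisors (A ⊗[k] B) := by
    constructor
    intro u v huv
    by_contra! hne
    obtain ⟨hu, hv⟩ := hne
    let b := Algebra.TensorProduct.basis A (Module.Free.chooseBasis k B)
    obtain ⟨i, hi⟩ : ∃ i, b.repr u i ≠ 0 := by
      by_contra! h
      exact hu (b.repr.map_eq_zero_iff.1 (Finsupp.ext h))
    obtain ⟨j, hj⟩ : ∃ j, b.repr v j ≠ 0 := by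
      by_contra! h
      exact hv (b.repr.map_eq_zero_iff.1 (Finsupp.ext h))
    obtain ⟨ε, hε⟩ := exists_algHom_ne_zero k A (mul_ne_zero hi hj)
    let Φ : A ⊗[k] B →ₐ[k] k ⊗[k] B := Algebra.TensorProduct.map ε (AlgHom.id k B)
    let c := Algebra.TensorProduct.basis k (Module.Free.chooseBasis k B)
    have key (w) (l) : c.repr (Φ w) l = ε (b.repr w l) := by
      induction w using TensorProduct.induction_on with
      | zero => simp
      | add x y hx hy => simp [hx, hy]
      | tmul x y => simp [Φ, b, c]
    have : IsDomain (k ⊗[k] B) := (Algebra.TensorProduct.lid k B).toMulEquiv.isDomain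
    have hz : Φ u * Φ v = 0 := by rw [← map_mul, huv, map_zero]
    rw [map_mul] at hε
    rcases mul_eq_zero.1 hz with h | h
    · have := key u i
      rw [h] at this
      simp_all
    · have := key v j
      rw [h] at this
      simp_all
  exact NoZeroDivisors.to_isDomain _

section
variable {A : Type*} [CommRing A] [IsNoetherianRing A]

theorem Ideal.exists_isPrime_ne_bot_lt_notMem [IsDomain A] {h : A} (hh : h ≠ 0) (P : Ideal A)
    [P.IsPrime] (hP : 2 ≤ P.height) : ∃ Q : Ideal A, Q.IsPrime ∧ Q ≠ ⊥ ∧ Q < P ∧ h ∉ Q := by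
  have hfin := (Ideal.span {h}).finite_minimalPrimes_of_isNoetherianRing
  obtain ⟨c, hcP, hc0, hc⟩ : ∃ c ∈ P, c ≠ 0 ∧ ∀ I ∈ (Ideal.span {h}).minimalPrimes, c ∉ I := by
    by_contra! hcon
    have hsub : (P : Set A) ⊆ ⋃ I ∈ insert ⊥ (Ideal.span {h}).minimalPrimes, (I : Set A) := by
      intro c hc
      by_cases h0 : c = 0
      · simp [h0]
      · obtain ⟨I, hI, hcI⟩ := hcon c hc h0
        simp only [Set.mem_iUnion]
        exact ⟨I, Or.inr hI, hcI⟩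
    rw [Ideal.subset_union_prime_finite (hfin.insert _) ⊥ ⊥] at hsub
    · obtain ⟨I, hI | hI, hPI⟩ := hsub
      · subst hI
        rw [le_bot_iff.1 hPI, Ideal.height_bot] at hP
        simp at hP
      · have : I.IsPrime := hI.1.1
        have h1 := Ideal.height_le_one_of_isPrincipal_of_mem_minimalPrimes (Ideal.span {h}) I hI
        have := (hP.trans (Ideal.height_mono hPI)).trans h1
        norm_num at this
    · rintro I (rfl | hI) - -
      · exact Ideal.isPrime_bot
      · exact hI.1.1
  obtain ⟨Q, hQ, hQP⟩ := Ideal.exists_minimalPrimes_le (I := Ideal.span {c}) (J := P)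
    ((Ideal.span_singleton_le_iff_mem _).2 hcP)
  have : Q.IsPrime := hQ.1.1
  have hQ1 := Ideal.height_le_one_of_isPrincipal_of_mem_minimalPrimes (Ideal.span {c}) Q hQ
  have hcQ : c ∈ Q := hQ.1.2 (Ideal.mem_span_singleton_self c)
  refine ⟨Q, this, ?_, ?_, ?_⟩
  · rintro rfl
    exact hc0 hcQ
  · refine lt_of_le_of_ne hQP ?_
    rintro rfl
    have := hP.trans hQ1
    norm_num at this
  · intro hhQ
    obtain ⟨I, hI, hIQ⟩ := Ideal.exists_minimalPrimes_le (I := Ideal.span {h}) (J := Q)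
      ((Ideal.span_singleton_le_iff_mem _).2 hhQ)
    have : I.IsPrime := hI.1.1
    have hI0 : I ≠ ⊥ := by
      rintro rfl
      exact hh (hI.1.2 (Ideal.mem_span_singleton_self h))
    have hne : I ≠ Q := by
      rintro rfl
      exact hc I hI hcQ
    have h1 := Ideal.height_add_one_le_of_lt_of_isPrime (bot_lt_iff_ne_bot.2 hI0)
    have h2 := Ideal.height_add_one_le_of_lt_of_isPrime (lt_of_le_of_ne hIQ hne)
    have : (1 : ℕ∞) + 1 ≤ 1 := le_trans (by gcongr; exact le_trans (by simp) h1) (h2.trans hQ1)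
    norm_num at this

theorem Ideal.exists_isPrime_between_notMem {h : A} {I J P : Ideal A} [I.IsPrime] [J.IsPrime]
    [P.IsPrime] (hIJ : I < J) (hJP : J < P) (hh : h ∉ I) :
    ∃ Q : Ideal A, Q.IsPrime ∧ I < Q ∧ Q < P ∧ h ∉ Q := by
  have hker : RingHom.ker (Ideal.Quotient.mk I) = I := Ideal.mk_ker
  have hsurj := Ideal.Quotient.mk_surjective (I := I)
  have := Ideal.isPrime_map_quotientMk_of_isPrime hIJ.le
  have := Ideal.isPrime_map_quotientMk_of_isPrime (hIJ.trans hJP).le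
  have comap_map (K : Ideal A) (hK : I ≤ K) :
      (K.map (Ideal.Quotient.mk I)).comap (Ideal.Quotient.mk I) = K := by
    rw [Ideal.comap_map_of_surjective _ hsurj]
    simpa [← RingHom.ker_eq_comap_bot] using hK
  have hlt : J.map (Ideal.Quotient.mk I) < P.map (Ideal.Quotient.mk I) := by
    refine lt_of_le_of_ne (Ideal.map_mono hJP.le) fun he => hJP.ne ?_
    rw [← comap_map J hIJ.le, he, comap_map P (hIJ.trans hJP).le]
  have hlt0 : ⊥ < J.map (Ideal.Quotient.mk I) := by
    refine bot_lt_iff_ne_bot.2 fun he => hIJ.ne' ?_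
    rw [← comap_map J hIJ.le, he, ← RingHom.ker_eq_comap_bot, hker]
  have h1 := Ideal.height_add_one_le_of_lt_of_isPrime hlt0
  have h2 := Ideal.height_add_one_le_of_lt_of_isPrime hlt
  obtain ⟨Q, hQ, hQ0, hQP, hhQ⟩ := Ideal.exists_isPrime_ne_bot_lt_notMem
    (h := Ideal.Quotient.mk I h) (by simpa [Ideal.Quotient.eq_zero_iff_mem] using hh)
    (P.map (Ideal.Quotient.mk I))
    (by
      rw [← one_add_one_eq_two]
      exact le_trans (by gcongr; exact le_trans (by simp) h1) h2)
  refine ⟨Q.comap (Ideal.Quotient.mk I), inferInstance, ?_, ?_, by simpa using hhQ⟩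
  · refine lt_of_le_of_ne ?_ fun he => hQ0 ?_
    · conv_lhs => rw [← hker]
      exact Ideal.ker_le_comap _
    · rw [← Ideal.map_comap_of_surjective _ hsurj Q, ← he, Ideal.map_quotient_self]
  · refine lt_of_le_of_ne ?_ fun he => hQP.ne ?_
    · rw [← comap_map P (hIJ.trans hJP).le]
      exact Ideal.comap_mono hQP.le
    · rw [← Ideal.map_comap_of_surjective _ hsurj Q, he]

theorem Ideal.exists_isPrime_lt_notMem_le_height [IsDomain A] {h : A} (hh : h ≠ 0) (n : ℕ)
    (P : Ideal A) [P.IsPrime] (hP : (n + 1 : ℕ) ≤ P.height) :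
    ∃ Q : Ideal A, Q.IsPrime ∧ Q < P ∧ h ∉ Q ∧ n ≤ Q.height := by
  induction n generalizing P with
  | zero =>
    refine ⟨⊥, Ideal.isPrime_bot, bot_lt_iff_ne_bot.2 ?_, by simpa using hh, by simp⟩
    rintro rfl
    simp at hP
  | succ n ih =>
    obtain ⟨P₁, hP₁, hlt, hht⟩ : ∃ P₁ : Ideal A, P₁.IsPrime ∧ P₁ < P ∧ (n + 1 : ℕ) ≤ P₁.height := by
      by_contra! hcon
      have := Order.height_le_coe_iff (x := (⟨P, ‹_›⟩ : PrimeSpectrum A)) (n := n + 1).2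
        fun y hy => by
          rw [← PrimeSpectrum.height_eq_orderHeight]
          exact hcon y.asIdeal y.isPrime hy
      rw [← PrimeSpectrum.height_eq_orderHeight] at this
      have := hP.trans this
      norm_cast at this
      omega
    obtain ⟨Q₁, hQ₁, hlt₁, hhQ₁, hn⟩ := ih P₁ hht
    obtain ⟨Q, hQ, hQ₁Q, hQP, hhQ⟩ := Ideal.exists_isPrime_between_notMem hlt₁ hlt hhQ₁
    refine ⟨Q, hQ, hQP, hhQ, ?_⟩
    push_cast
    exact le_trans (by gcongr) (Ideal.height_add_one_le_of_lt_of_isPrime hQ₁Q)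

theorem Ideal.exists_isMaximal_notMem_le_height [IsDomain A] [IsJacobsonRing A] {h : A}
    (hh : h ≠ 0) (n : ℕ) (P : Ideal A) [P.IsPrime] (hP : (n + 1 : ℕ) ≤ P.height) :
    ∃ M : Ideal A, M.IsMaximal ∧ h ∉ M ∧ (n + 1 : ℕ) ≤ M.height := by
  obtain ⟨Q, hQ, hQP, hhQ, hn⟩ := Ideal.exists_isPrime_lt_notMem_le_height hh n P hP
  have hQM : ¬ Q.IsMaximal := fun hQM => ‹P.IsPrime›.ne_top (hQM.1.2 P hQP)
  obtain ⟨M, hM, hle, hhM⟩ := Ideal.exists_isMaximal_le_notMem hhQ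
  have hlt : Q < M := lt_of_le_of_ne hle (by rintro rfl; exact hQM hM)
  refine ⟨M, hM, hhM, ?_⟩
  push_cast
  exact le_trans (by gcongr) (Ideal.height_add_one_le_of_lt_of_isPrime hlt)

/-- Cutting down a prime of height at least `n` by `e` equations leaves a chain of length
`n - e`. -/
theorem Ideal.exists_ltSeries_of_subset {n e : ℕ} {P : Ideal A} [P.IsPrime] (hP : n ≤ P.height)
    (s : Finset A) (hs : s.card ≤ e) (hsP : (s : Set A) ⊆ P) :
    ∃ l : LTSeries (PrimeSpectrum A), l.length = n - e ∧ (s : Set A) ⊆ l.head.asIdeal ∧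
      l.last.asIdeal = P := by
  have hle : Ideal.span (s : Set A) ≤ P := Ideal.span_le.2 hsP
  have hp := Ideal.isPrime_map_quotientMk_of_isPrime hle
  have h1 := hP.trans (Ideal.height_le_height_add_encard_of_subset (s : Set A) hsP)
  rw [Set.encard_coe_eq_coe_finsetCard] at h1
  have h2 : ((n - e : ℕ) : ℕ∞) ≤ (P.map (Ideal.Quotient.mk (Ideal.span (s : Set A)))).height := by
    push_cast
    rw [tsub_le_iff_right]
    exact h1.trans (by gcongr)
  rw [show (P.map (Ideal.Quotient.mk (Ideal.span (s : Set A)))).height =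
    Order.height (⟨_, hp⟩ : PrimeSpectrum (A ⧸ Ideal.span (s : Set A))) from
    PrimeSpectrum.height_eq_orderHeight ⟨_, hp⟩] at h2
  obtain ⟨l, hl, hlen⟩ := Order.exists_series_of_le_height _ h2
  have hmono : StrictMono (PrimeSpectrum.comap (Ideal.Quotient.mk (Ideal.span (s : Set A)))) :=
    Monotone.strictMono_of_injective (fun a b hab => Ideal.comap_mono hab)
      (PrimeSpectrum.comap_injective_of_surjective _ Ideal.Quotient.mk_surjective)
  refine ⟨l.map _ hmono, hlen, ?_, ?_⟩
  · intro x hx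
    have : Ideal.Quotient.mk (Ideal.span (s : Set A)) x = 0 :=
      Ideal.Quotient.eq_zero_iff_mem.2 (Ideal.subset_span hx)
    simp [LTSeries.head_map, this]
  · rw [LTSeries.last_map, hl, PrimeSpectrum.comap_asIdeal,
      Ideal.comap_map_of_surjective _ Ideal.Quotient.mk_surjective, ← RingHom.ker_eq_comap_bot,
      Ideal.mk_ker]
    simpa using hle

theorem Ideal.exists_ltSeries_comap_eq {R : Type*} [CommRing R] [IsNoetherianRing R] (θ : R →+* A)
    {n e : ℕ} (he : ringKrullDim R ≤ e) (P : Ideal A) [hPp : P.IsPrime] (hP : n ≤ P.height) :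
    ∃ l : LTSeries (PrimeSpectrum A), l.length = n - e ∧
      PrimeSpectrum.comap θ l.head = PrimeSpectrum.comap θ ⟨P, hPp⟩ := by
  classical
  obtain ⟨s, hs, hcard⟩ := Ideal.exists_finset_card_eq_height_of_isNoetherianRing (P.comap θ)
  have hse : s.card ≤ e := by
    have := (WithBot.coe_le_coe.2 hcard.le).trans
      (Ideal.height_le_ringKrullDim_of_isPrime.trans he)
    exact_mod_cast this
  obtain ⟨l, hl, hsl, hlast⟩ := Ideal.exists_ltSeries_of_subset hP (s.image θ)
    (Finset.card_image_le.trans hse) (by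
      intro x hx
      simp only [Finset.coe_image, Set.mem_image] at hx
      obtain ⟨y, hy, rfl⟩ := hx
      exact hs.1.2 (Ideal.subset_span hy))
  have hlP : l.head.asIdeal ≤ P := hlast ▸ l.head_le_last
  refine ⟨l, hl, PrimeSpectrum.ext (le_antisymm (Ideal.comap_mono hlP) ?_)⟩
  refine hs.2 ⟨inferInstance, Ideal.span_le.2 fun y hy => ?_⟩ (Ideal.comap_mono hlP)
  exact hsl (by simpa using ⟨y, hy, rfl⟩)

end

theorem LTSeries.length_le_card_of_mem_minimalPrimes {C : Type*} [CommRing C] [IsNoetherianRing C]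
    (l : LTSeries (PrimeSpectrum C)) (s : Finset C)
    (h : l.last.asIdeal ∈ (Ideal.span (s : Set C) ⊔ l.head.asIdeal).minimalPrimes) :
    l.length ≤ s.card := by
  classical
  let π := Ideal.Quotient.mk l.head.asIdeal
  have hπ : Function.Surjective π := Ideal.Quotient.mk_surjective
  have hle (i) : l.head.asIdeal ≤ (l i).asIdeal := l.monotone (Fin.zero_le i)
  have hcm (i) : ((l i).asIdeal.map π).comap π = (l i).asIdeal := by
    rw [Ideal.comap_map_of_surjective _ hπ]
    simpa [← RingHom.ker_eq_comap_bot, π] using hle i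
  let l' : LTSeries (PrimeSpectrum (C ⧸ l.head.asIdeal)) :=
    { length := l.length
      toFun := fun i => ⟨(l i).asIdeal.map π, Ideal.isPrime_map_quotientMk_of_isPrime (hle i)⟩
      step := fun i => by
        refine lt_of_le_of_ne (Ideal.map_mono (l.strictMono i.castSucc_lt_succ).le) fun he =>
          (l.strictMono i.castSucc_lt_succ).ne ?_
        exact PrimeSpectrum.ext <|
          (hcm i.castSucc).symm.trans ((congrArg (Ideal.comap π) he).trans (hcm i.succ)) }
  have hmem : l.last.asIdeal.map π ∈ (Ideal.span ((s.image π : Finset _) : Set _)).minimalPrimes := by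
    rw [Finset.coe_image, ← Ideal.map_span, Ideal.minimalPrimes_map_of_surjective hπ, Ideal.mk_ker]
    exact ⟨_, h, rfl⟩
  have h1 := Ideal.height_le_card_of_mem_minimalPrimes_span_finset hmem
  have h2 : (l'.length : ℕ∞) ≤ Order.height l'.last := Order.length_le_height_last
  rw [← PrimeSpectrum.height_eq_orderHeight] at h2
  have h3 : l'.length ≤ (s.image π).card := by exact_mod_cast h2.trans h1
  exact h3.trans Finset.card_image_le

section TensorPrime
variable {k A B : Type*} [Field k] [CommRing A] [CommRing B] [Algebra k A] [Algebra k B]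

variable (k) in
/-- The ideal `p ⊗ B + A ⊗ q` of `A ⊗ B`. -/
def Ideal.tensorSup (p : Ideal A) (q : Ideal B) : Ideal (A ⊗[k] B) :=
  p.map (Algebra.TensorProduct.includeLeft : A →ₐ[k] A ⊗[k] B) ⊔
    q.map (Algebra.TensorProduct.includeRight : B →ₐ[k] A ⊗[k] B)

theorem Ideal.ker_map_mk_eq_tensorSup (p : Ideal A) (q : Ideal B) :
    RingHom.ker (Algebra.TensorProduct.map (Ideal.Quotient.mkₐ k p) (Ideal.Quotient.mkₐ k q)) =
      Ideal.tensorSup k p q := by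
  rw [Algebra.TensorProduct.map_ker _ _ (Ideal.Quotient.mkₐ_surjective k p)
    (Ideal.Quotient.mkₐ_surjective k q)]
  have h₁ : RingHom.ker (Ideal.Quotient.mkₐ k p) = p := Ideal.Quotient.mkₐ_ker k p
  have h₂ : RingHom.ker (Ideal.Quotient.mkₐ k q) = q := Ideal.Quotient.mkₐ_ker k q
  rw [h₁, h₂]
  rfl

theorem Ideal.isPrime_tensorSup [IsAlgClosed k] [Algebra.FiniteType k A] (p : Ideal A)
    (q : Ideal B) [p.IsPrime] [q.IsPrime] : (Ideal.tensorSup k p q).IsPrime := by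
  have := isDomain_tensorProduct_of_isAlgClosed k (A ⧸ p) (B ⧸ q)
  rw [← Ideal.ker_map_mk_eq_tensorSup]
  exact RingHom.ker_isPrime _

theorem Ideal.includeLeft_mem_tensorSup (p : Ideal A) (q : Ideal B) [q.IsPrime] (a : A) :
    a ⊗ₜ[k] (1 : B) ∈ Ideal.tensorSup k p q ↔ a ∈ p := by
  rw [← Ideal.ker_map_mk_eq_tensorSup, RingHom.mem_ker, Algebra.TensorProduct.map_tmul, map_one,
    ← Ideal.Quotient.eq_zero_iff_mem]
  have := Algebra.TensorProduct.includeLeft_injective (R := k) (S := k) (A := A ⧸ p) (B := B ⧸ q)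
    (algebraMap k (B ⧸ q)).injective
  exact map_eq_zero_iff Algebra.TensorProduct.includeLeft this

theorem Ideal.includeRight_mem_tensorSup (p : Ideal A) (q : Ideal B) [p.IsPrime] (b : B) :
    (1 : A) ⊗ₜ[k] b ∈ Ideal.tensorSup k p q ↔ b ∈ q := by
  rw [← Ideal.ker_map_mk_eq_tensorSup, RingHom.mem_ker, Algebra.TensorProduct.map_tmul, map_one,
    ← Ideal.Quotient.eq_zero_iff_mem]
  have := Algebra.TensorProduct.includeRight_injective (R := k) (A := A ⧸ p) (B := B ⧸ q)
    (algebraMap k (A ⧸ p)).injective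
  exact map_eq_zero_iff Algebra.TensorProduct.includeRight this

theorem Ideal.tensorSup_le_iff {p : Ideal A} {q : Ideal B} {N : Ideal (A ⊗[k] B)} :
    Ideal.tensorSup k p q ≤ N ↔
      (∀ a ∈ p, a ⊗ₜ[k] (1 : B) ∈ N) ∧ ∀ b ∈ q, (1 : A) ⊗ₜ[k] b ∈ N := by
  rw [Ideal.tensorSup, sup_le_iff, Ideal.map_le_iff_le_comap, Ideal.map_le_iff_le_comap]
  rfl

theorem Ideal.tensorSup_mono {p p' : Ideal A} {q q' : Ideal B} (hp : p ≤ p') (hq : q ≤ q') :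
    Ideal.tensorSup k p q ≤ Ideal.tensorSup k p' q' :=
  sup_le_sup (Ideal.map_mono hp) (Ideal.map_mono hq)

variable (k) in
/-- The point of `Spec (A ⊗ B)` determined by a point of `Spec A` and a point of `Spec B`. -/
def PrimeSpectrum.tensorSup [IsAlgClosed k] [Algebra.FiniteType k A] (p : PrimeSpectrum A)
    (q : PrimeSpectrum B) : PrimeSpectrum (A ⊗[k] B) :=
  ⟨Ideal.tensorSup k p.asIdeal q.asIdeal, Ideal.isPrime_tensorSup _ _⟩

theorem PrimeSpectrum.tensorSup_strictMono_left [IsAlgClosed k] [Algebra.FiniteType k A]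
    (q : PrimeSpectrum B) :
    StrictMono fun p : PrimeSpectrum A => PrimeSpectrum.tensorSup k p q := by
  refine Monotone.strictMono_of_injective (fun _ _ h => Ideal.tensorSup_mono h le_rfl) ?_
  intro p p' h
  ext a
  rw [← Ideal.includeLeft_mem_tensorSup (k := k) _ q.asIdeal,
    ← Ideal.includeLeft_mem_tensorSup (k := k) p'.asIdeal q.asIdeal]
  exact (congrArg (a ⊗ₜ[k] (1 : B) ∈ ·.asIdeal) h).to_iff

theorem PrimeSpectrum.tensorSup_strictMono_right [IsAlgClosed k] [Algebra.FiniteType k A]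
    (p : PrimeSpectrum A) :
    StrictMono fun q : PrimeSpectrum B => PrimeSpectrum.tensorSup k p q := by
  refine Monotone.strictMono_of_injective (fun _ _ h => Ideal.tensorSup_mono le_rfl h) ?_
  intro q q' h
  ext b
  rw [← Ideal.includeRight_mem_tensorSup (k := k) p.asIdeal,
    ← Ideal.includeRight_mem_tensorSup (k := k) p.asIdeal q'.asIdeal]
  exact (congrArg ((1 : A) ⊗ₜ[k] b ∈ ·.asIdeal) h).to_iff

end TensorPrime

/-- Affine dimension inequality for intersections, at an isolated point of the intersection. -/
theorem MvPolynomial.length_add_length_le {k σ : Type*} [Field k] [IsAlgClosed k] [Fintype σ]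
    (l₁ l₂ : LTSeries (PrimeSpectrum (MvPolynomial σ k))) (hlast : l₁.last = l₂.last)
    (hX : ∀ i, X i ∈ l₁.last.asIdeal)
    (hmin : l₁.last.asIdeal ∈ (l₁.head.asIdeal ⊔ l₂.head.asIdeal).minimalPrimes) :
    l₁.length + l₂.length ≤ Fintype.card σ := by
  classical
  let R := MvPolynomial σ k
  let L₁ := l₁.map _ (PrimeSpectrum.tensorSup_strictMono_left (k := k) l₂.head)
  let L₂ := l₂.map _ (PrimeSpectrum.tensorSup_strictMono_right (k := k) l₁.last)
  have hconn : L₁.last = L₂.head := by simp [L₁, L₂, LTSeries.last_map, LTSeries.head_map]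
  let L := RelSeries.smash L₁ L₂ hconn
  let D : Finset (R ⊗[k] R) := Finset.univ.image fun i : σ =>
    (X i : R) ⊗ₜ[k] (1 : R) - (1 : R) ⊗ₜ[k] (X i : R)
  have hDcard : D.card ≤ Fintype.card σ := Finset.card_image_le
  have hhead : L.head = PrimeSpectrum.tensorSup k l₁.head l₂.head := by
    rw [RelSeries.head_smash, LTSeries.head_map]
  have hL : L.last = PrimeSpectrum.tensorSup k l₁.last l₁.last := by
    rw [RelSeries.last_smash, LTSeries.last_map, hlast]
  have : IsNoetherianRing (R ⊗[k] R) := Algebra.FiniteType.isNoetherianRing R _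
  refine le_trans ?_ hDcard
  refine LTSeries.length_le_card_of_mem_minimalPrimes L D ⟨⟨L.last.isPrime, sup_le ?_ ?_⟩, ?_⟩
  · rw [hL, Ideal.span_le]
    intro z hz
    simp only [D, Finset.coe_image, Finset.coe_univ, Set.image_univ, Set.mem_range] at hz
    obtain ⟨i, rfl⟩ := hz
    exact sub_mem ((Ideal.includeLeft_mem_tensorSup _ _ _).2 (hX i))
      ((Ideal.includeRight_mem_tensorSup _ _ _).2 (hX i))
  · exact LTSeries.head_le_last L
  · rintro N ⟨hN, hDN⟩ hNM
    have hdiag (a : R) : a ⊗ₜ[k] (1 : R) ∈ N ↔ (1 : R) ⊗ₜ[k] a ∈ N := by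
      have : (Ideal.Quotient.mkₐ k N).comp (Algebra.TensorProduct.includeLeft : R →ₐ[k] R ⊗[k] R) =
          (Ideal.Quotient.mkₐ k N).comp Algebra.TensorProduct.includeRight := by
        refine MvPolynomial.algHom_ext fun i => ?_
        refine Ideal.Quotient.eq.2 ((le_sup_left.trans hDN) (Ideal.subset_span ?_))
        simp [D]
      have := DFunLike.congr_fun this a
      rw [← Ideal.Quotient.eq_zero_iff_mem, ← Ideal.Quotient.eq_zero_iff_mem]
      exact (congrArg (· = 0) this).to_iff
    let n : Ideal R := N.comap (Algebra.TensorProduct.includeLeft : R →ₐ[k] R ⊗[k] R)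
    have hn (a : R) : a ∈ n ↔ a ⊗ₜ[k] (1 : R) ∈ N := Iff.rfl
    have hheads := Ideal.tensorSup_le_iff.1
      ((congrArg PrimeSpectrum.asIdeal hhead).symm.le.trans (le_sup_right.trans hDN))
    rw [hL] at hNM ⊢
    have hnm : n ≤ l₁.last.asIdeal := fun a ha =>
      (Ideal.includeLeft_mem_tensorSup (k := k) _ l₁.last.asIdeal a).1 (hNM ha)
    have hprime : n.IsPrime := Ideal.comap_isPrime _ _
    have hsup : l₁.head.asIdeal ⊔ l₂.head.asIdeal ≤ n :=
      sup_le (fun a ha => (hn a).2 (hheads.1 a ha))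
        fun a ha => (hn a).2 ((hdiag a).2 (hheads.2 a ha))
    have hmn := hmin.2 ⟨hprime, hsup⟩ hnm
    exact Ideal.tensorSup_le_iff.2 ⟨fun a ha => hmn ha, fun a ha => (hdiag a).1 (hmn ha)⟩

section Projective
variable {σ k : Type*} [Field k]

theorem MvPolynomial.mem_irrelevant_iff_coeff_zero (p : MvPolynomial σ k) :
    p ∈ HomogeneousIdeal.irrelevant (homogeneousSubmodule σ k) ↔ coeff 0 p = 0 := by
  have h : GradedRing.proj (homogeneousSubmodule σ k) 0 p = C (coeff 0 p) :=
    (decomposition.decompose'_apply p 0).trans (homogeneousComponent_zero p)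
  rw [HomogeneousIdeal.mem_irrelevant_iff, h, C_eq_zero]

theorem MvPolynomial.isPrime_irrelevant :
    (HomogeneousIdeal.irrelevant (homogeneousSubmodule σ k)).toIdeal.IsPrime := by
  have h : (HomogeneousIdeal.irrelevant (homogeneousSubmodule σ k)).toIdeal =
      RingHom.ker (constantCoeff : MvPolynomial σ k →+* k) := by
    ext p
    exact mem_irrelevant_iff_coeff_zero p
  rw [h]
  exact RingHom.ker_isPrime _

theorem MvPolynomial.le_irrelevant_of_ne_top (I : HomogeneousIdeal (homogeneousSubmodule σ k))
    (hI : I.toIdeal ≠ ⊤) : I ≤ HomogeneousIdeal.irrelevant (homogeneousSubmodule σ k) := by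
  intro p hp
  rw [mem_irrelevant_iff_coeff_zero]
  by_contra hc
  have h : C (coeff 0 p) ∈ I.toIdeal := by
    rw [← homogeneousComponent_zero, ← decomposition.decompose'_apply p 0]
    exact I.isHomogeneous 0 hp
  exact hI (Ideal.eq_top_of_isUnit_mem _ h ((isUnit_iff_ne_zero.2 hc).map C))

/-- The prime of the polynomial ring underlying a point of its projective spectrum. -/
noncomputable def ProjectiveSpectrum.toPrimeSpectrum
    (x : ProjectiveSpectrum (homogeneousSubmodule σ k)) : PrimeSpectrum (MvPolynomial σ k) :=
  ⟨x.asHomogeneousIdeal.toIdeal, x.isPrime⟩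

theorem ProjectiveSpectrum.toPrimeSpectrum_strictMono :
    StrictMono (toPrimeSpectrum (σ := σ) (k := k)) := fun _ _ h => h

variable (σ k) in
/-- The irrelevant ideal as a point of the affine cone. -/
noncomputable def MvPolynomial.irrelevantPoint : PrimeSpectrum (MvPolynomial σ k) :=
  ⟨_, isPrime_irrelevant⟩

theorem ProjectiveSpectrum.toPrimeSpectrum_lt_irrelevantPoint
    (x : ProjectiveSpectrum (homogeneousSubmodule σ k)) :
    x.toPrimeSpectrum < irrelevantPoint σ k :=
  lt_of_le_not_ge (le_irrelevant_of_ne_top _ x.isPrime.ne_top) x.not_irrelevant_le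

/-- Chains of closed subvarieties of projective space of complementary length have
intersecting top members. -/
theorem ProjectiveSpectrum.exists_head_le_head_le [IsAlgClosed k] [Fintype σ]
    (l₁ l₂ : LTSeries (ProjectiveSpectrum (homogeneousSubmodule σ k)))
    (h : Fintype.card σ < l₁.length + l₂.length + 2) :
    ∃ w, l₁.head ≤ w ∧ l₂.head ≤ w := by
  by_contra! hw
  let L (l : LTSeries (ProjectiveSpectrum (homogeneousSubmodule σ k))) :
      LTSeries (PrimeSpectrum (MvPolynomial σ k)) :=
    (l.map _ toPrimeSpectrum_strictMono).snoc (irrelevantPoint σ k) (by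
      rw [LTSeries.last_map]; exact toPrimeSpectrum_lt_irrelevantPoint _)
  have hlast (l) : (L l).last = irrelevantPoint σ k := RelSeries.last_snoc _ _ _
  have hhead (l) : (L l).head = l.head.toPrimeSpectrum :=
    (RelSeries.head_snoc _ _ _).trans (LTSeries.head_map _ _ _)
  have hlen (l) : (L l).length = l.length + 1 := RelSeries.snoc_length _ _ _
  have hle := MvPolynomial.length_add_length_le (L l₁) (L l₂) (by rw [hlast, hlast]) (fun i => by
    rw [hlast]
    exact (mem_irrelevant_iff_coeff_zero _).2 (coeff_zero_X i)) (by
    refine ⟨⟨(L l₁).last.isPrime, ?_⟩, ?_⟩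
    · rw [hlast, hhead, hhead]
      exact sup_le (toPrimeSpectrum_lt_irrelevantPoint _).le
        (toPrimeSpectrum_lt_irrelevantPoint _).le
    · rintro N ⟨hN, hle⟩ -
      rw [hhead, hhead, sup_le_iff] at hle
      rw [hlast]
      have h₁ : l₁.head.asHomogeneousIdeal ≤ N.homogeneousCore (homogeneousSubmodule σ k) :=
        (Ideal.homogeneousCore.gc _ _ _).1 hle.1
      have h₂ : l₂.head.asHomogeneousIdeal ≤ N.homogeneousCore (homogeneousSubmodule σ k) :=
        (Ideal.homogeneousCore.gc _ _ _).1 hle.2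
      refine le_trans ?_ (Ideal.toIdeal_homogeneousCore_le (homogeneousSubmodule σ k) N)
      by_contra hirr
      exact hw ⟨_, hN.homogeneousCore, hirr⟩ h₁ h₂)
  rw [hlen, hlen] at hle
  omega
end Projective

theorem PrimeSpectrum.exists_ltSeries_not_specializes {X S T R A : Type*} [TopologicalSpace X]
    [TopologicalSpace S] [TopologicalSpace T] [CommRing R] [CommRing A] [IsNoetherianRing R]
    [IsNoetherianRing A] [IsDomain A] [IsJacobsonRing A] [JacobsonSpace X] {f : X → S}
    (hf : Continuous f) (hfc : IsClosedMap f) {φ : X → T} (hφ : IsClosedMap φ)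
    (hφi : Function.Injective φ) (θ : R →+* A) {i : PrimeSpectrum A → X} (hi : IsOpenEmbedding i)
    {j : PrimeSpectrum R → S} (hj : IsOpenEmbedding j)
    (hij : ∀ p, f (i p) = j (PrimeSpectrum.comap θ p)) (P : PrimeSpectrum A) {n e : ℕ}
    (hP : ((n + 1 : ℕ) : ℕ∞) ≤ P.asIdeal.height) (he : ringKrullDim R ≤ e) {g : R}
    (hg : θ g ≠ 0) (hgP : θ g ∈ P.asIdeal) :
    ∃ a b : LTSeries (PrimeSpectrum A), a.length = n ∧ b.length = n + 1 - e ∧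
      ∀ w, φ (i a.head) ⤳ w → ¬ φ (i b.head) ⤳ w := by
  obtain ⟨a, ha, hga, -⟩ := Ideal.exists_ltSeries_of_subset (e := 1) hP {θ g} (by simp)
    (by simpa using hgP)
  obtain ⟨M, hM, hgM, hMn⟩ := Ideal.exists_isMaximal_notMem_le_height hg n P.asIdeal hP
  obtain ⟨b, hb, hbM⟩ := Ideal.exists_ltSeries_comap_eq θ he M hMn
  refine ⟨a, b, by simpa using ha, hb, fun w haw hbw => ?_⟩
  obtain ⟨y, hay, rfl⟩ := hφ.specializingMap haw
  obtain ⟨z, hbz, hzy⟩ := hφ.specializingMap hbw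
  obtain rfl := hφi hzy
  set x : PrimeSpectrum A := ⟨M, hM.isPrime⟩
  have hx : IsClosed {x} := (PrimeSpectrum.isClosed_singleton_iff_isMaximal _).2 hM
  have hix : IsClosed {i x} := (Set.ext_iff.1 hi.preimage_closedPoints x).2 hx
  have hfx : IsClosed {f (i x)} := by simpa using hfc _ hix
  have hfz : f z = f (i x) := by
    have h := hbz.map hf
    rw [hij, hbM, ← hij] at h
    exact h.mem_closed hfx rfl
  have h := hay.map hf
  rw [hfz, hij, hij, hj.isInducing.specializes_iff, ← PrimeSpectrum.le_iff_specializes] at h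
  exact hgM (h (by simpa using hga))

theorem exists_isClosed_singleton_le_height {X : Type*} [TopologicalSpace X] [CompactSpace X]
    [T0Space X] [QuasiSober X] (l : LTSeries (IrreducibleCloseds X)) :
    ∃ x : X, IsClosed {x} ∧ ∀ {A : Type*} [CommRing A] {i : PrimeSpectrum A → X},
      IsOpenEmbedding i → ∀ P, i P = x → (l.length : ℕ∞) ≤ P.asIdeal.height := by
  obtain ⟨x, hxl, hx⟩ := (l 0).isClosed.exists_closed_singleton (l 0).isIrreducible.nonempty
  refine ⟨x, hx, fun {A} _ {i} hi P hP => ?_⟩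
  choose η hη using fun k => QuasiSober.sober (l k).isIrreducible (l k).isClosed
  have hηx (k) : η k ⤳ x := (hη k).specializes (l.monotone (Fin.zero_le k) hxl)
  have hmem (k) : η k ∈ Set.range i :=
    (hηx k).mem_open hi.isOpen_range ⟨P, hP⟩
  choose p hp using hmem
  have hanti : StrictAnti p := by
    refine Antitone.strictAnti_of_injective (fun k m hkm => ?_) fun k m hkm => ?_
    · rw [PrimeSpectrum.le_iff_specializes, ← hi.isInducing.specializes_iff, hp, hp]
      exact (hη m).specializes (l.monotone hkm (hη k).mem)
    · refine l.strictMono.injective (IrreducibleCloseds.ext ?_)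
      rw [← (hη k).def, ← (hη m).def, ← hp, ← hp, hkm]
  let L : LTSeries (PrimeSpectrum A) := LTSeries.mk l.length (p ∘ Fin.rev)
    (hanti.comp Fin.rev_strictAnti)
  rw [PrimeSpectrum.height_eq_orderHeight]
  refine Order.length_le_height (p := L) ?_
  rw [PrimeSpectrum.le_iff_specializes, ← hi.isInducing.specializes_iff, hP]
  change i (p _) ⤳ x
  rw [hp]
  exact hηx _

theorem PrimeSpectrum.specializes_of_isOpenEmbedding {X A : Type*} [TopologicalSpace X]
    [PreirreducibleSpace X] [CommRing A] [IsDomain A] {i : PrimeSpectrum A → X}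
    (hi : IsOpenEmbedding i) (y : X) : i ⊥ ⤳ y := by
  have hrange : Set.range i ⊆ closure {i ⊥} := by
    rintro _ ⟨p, rfl⟩
    exact (((PrimeSpectrum.le_iff_specializes _ _).1 bot_le).map hi.continuous).mem_closure
  have hdense : Dense (Set.range i) := hi.isOpen_range.dense (Set.range_nonempty i)
  exact specializes_iff_mem_closure.2 (closure_minimal hrange isClosed_closure (hdense y))

theorem PrimeSpectrum.injective_of_surjective {X S R A : Type*} [TopologicalSpace X]
    [TopologicalSpace S] [PreirreducibleSpace X] [CommRing R] [CommRing A] [IsDomain R]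
    [IsDomain A] {f : X → S} (hf : Continuous f) (hsurj : Function.Surjective f)
    {θ : R →+* A} {i : PrimeSpectrum A → X} (hi : IsOpenEmbedding i)
    {j : PrimeSpectrum R → S} (hj : IsOpenEmbedding j)
    (hij : ∀ p, f (i p) = j (PrimeSpectrum.comap θ p)) : Function.Injective θ := by
  obtain ⟨y, hy⟩ := hsurj (j ⊥)
  have h := (specializes_of_isOpenEmbedding hi y).map hf
  rw [hij, hy, hj.isInducing.specializes_iff, ← PrimeSpectrum.le_iff_specializes] at h
  rw [injective_iff_map_eq_zero]
  intro a ha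
  exact h (by simpa using ha)

theorem PrimeSpectrum.exists_mem_ne_zero {S R : Type*} [TopologicalSpace S]
    [PreirreducibleSpace S] [CommRing R] [IsDomain R] (hS : 1 ≤ topologicalKrullDim S)
    {j : PrimeSpectrum R → S} (hj : IsOpenEmbedding j) (p : PrimeSpectrum R)
    (hp : IsClosed {j p}) : ∃ g ∈ p.asIdeal, g ≠ 0 := by
  by_contra! hbot
  obtain rfl : p = ⊥ := PrimeSpectrum.ext ((Submodule.eq_bot_iff _).2 hbot)
  have : Subsingleton S := subsingleton_of_forall_eq (j ⊥) fun y =>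
    (specializes_of_isOpenEmbedding hj y).mem_closed hp rfl
  exact absurd (hS.trans (topologicalKrullDim_zero_of_discreteTopology S)) (by decide)

instance (n : ℕ) : IsSeparated (ProjSpace.structMor n) := by
  unfold ProjSpace.structMor
  have h₁ := Proj.isSeparated (homogeneousSubmodule (Fin (n + 1)) ℂ)
  have h₂ : IsSeparated (Spec.map (CommRingCat.ofHom
      ((GradedRing.projZeroRingHom' (homogeneousSubmodule (Fin (n + 1)) ℂ)).comp
        (C : ℂ →+* MvPolynomial (Fin (n + 1)) ℂ)))) := inferInstance
  exact MorphismProperty.comp_mem _ _ _ h₁ h₂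

theorem ProjSpace.exists_specializes {s : ℕ} {A : Type*} [CommRing A]
    {ψ : PrimeSpectrum A → ProjSpace s} (hψ : Continuous ψ) (hinj : Function.Injective ψ)
    (a b : LTSeries (PrimeSpectrum A)) (h : s < a.length + b.length + 1) :
    ∃ w, ψ a.head ⤳ w ∧ ψ b.head ⤳ w := by
  let ψ' : PrimeSpectrum A → ProjectiveSpectrum (homogeneousSubmodule (Fin (s + 1)) ℂ) := ψ
  have hle (x y : ProjectiveSpectrum (homogeneousSubmodule (Fin (s + 1)) ℂ)) :
      x ≤ y ↔ x ⤳ y := by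
    rw [ProjectiveSpectrum.le_iff_mem_closure, specializes_iff_mem_closure]
  have hmono : StrictMono ψ' := by
    refine Monotone.strictMono_of_injective (fun p q hpq => ?_) hinj
    rw [hle]
    exact ((PrimeSpectrum.le_iff_specializes p q).1 hpq).map hψ
  obtain ⟨w, ha, hb⟩ := ProjectiveSpectrum.exists_head_le_head_le (a.map ψ' hmono)
    (b.map ψ' hmono) (by simpa using by omega)
  rw [LTSeries.head_map, hle] at ha hb
  exact ⟨w, ha, hb⟩

/-- The dimension bound for a single chain of irreducible closed subsets of `X`. -/
theorem ProjSpace.length_add_length_le (X S : Scheme) [IsReduced X] [IsReduced S]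
    [IrreducibleSpace X] [IrreducibleSpace S]
    (sX : X ⟶ Spec (CommRingCat.of ℂ)) [IsProper sX]
    (sS : S ⟶ Spec (CommRingCat.of ℂ)) [IsProper sS]
    (f : X ⟶ S) (hf : f ≫ sS = sX) (hsurj : Function.Surjective f.base)
    (hdimS : 1 ≤ topologicalKrullDim S)
    (s : ℕ) (φ : X ⟶ ProjSpace s) (hφ : φ ≫ ProjSpace.structMor s = sX)
    (hinj : Function.Injective φ.base) {e : ℕ} (he : topologicalKrullDim S ≤ e)
    (l : LTSeries (IrreducibleCloseds X)) : l.length + l.length ≤ s + e := by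
  have : IsIntegral X := isIntegral_of_irreducibleSpace_of_isReduced X
  have : IsIntegral S := isIntegral_of_irreducibleSpace_of_isReduced S
  have : IsProper f := by
    have : IsProper (f ≫ sS) := hf ▸ inferInstance
    exact IsProper.of_comp f sS
  have : IsProper φ := by
    have : IsProper (φ ≫ ProjSpace.structMor s) := hφ ▸ inferInstance
    exact IsProper.of_comp φ (ProjSpace.structMor s)
  have hnoeth : IsNoetherianRing (CommRingCat.of ℂ) := inferInstanceAs (IsNoetherianRing ℂ)
  have hjac : IsJacobsonRing (CommRingCat.of ℂ) := inferInstanceAs (IsJacobsonRing ℂ)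
  have : IsLocallyNoetherian X := LocallyOfFiniteType.isLocallyNoetherian sX
  have : IsLocallyNoetherian S := LocallyOfFiniteType.isLocallyNoetherian sS
  have : JacobsonSpace X := LocallyOfFiniteType.jacobsonSpace sX
  have : CompactSpace X := QuasiCompact.compactSpace_of_compactSpace sX
  obtain ⟨x, hx, hheight⟩ := exists_isClosed_singleton_le_height l
  obtain ⟨U, hU, hxU, -⟩ := exists_isAffineOpen_mem_and_subset (X := S) (x := f x)
    (U := ⊤) trivial
  obtain ⟨V, hV, hxV, hVU⟩ := exists_isAffineOpen_mem_and_subset (X := X) (x := x)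
    (U := f ⁻¹ᵁ U) hxU
  let θ := (f.appLE U V hVU).hom
  let i : PrimeSpectrum Γ(X, V) → X := hV.fromSpec
  let j : PrimeSpectrum Γ(S, U) → S := hU.fromSpec
  have hi : IsOpenEmbedding i := hV.fromSpec.isOpenEmbedding
  have hj : IsOpenEmbedding j := hU.fromSpec.isOpenEmbedding
  have hij (p) : f (i p) = j (PrimeSpectrum.comap θ p) :=
    congrArg (fun k => k.base p) (IsAffineOpen.SpecMap_appLE_fromSpec f hU hV hVU).symm
  have : Nonempty U := ⟨⟨_, hxU⟩⟩
  have : Nonempty V := ⟨⟨_, hxV⟩⟩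
  have : IsNoetherianRing Γ(S, U) := IsLocallyNoetherian.component_noetherian ⟨U, hU⟩
  have : IsNoetherianRing Γ(X, V) := IsLocallyNoetherian.component_noetherian ⟨V, hV⟩
  have : IsJacobsonRing Γ(X, V) :=
    PrimeSpectrum.isJacobsonRing_iff_jacobsonSpace.2 (JacobsonSpace.of_isOpenEmbedding hi)
  obtain ⟨P, hP⟩ : x ∈ Set.range i := hV.range_fromSpec ▸ hxV
  have hn := hheight hi P hP
  have hθ : Function.Injective θ :=
    PrimeSpectrum.injective_of_surjective f.continuous hsurj hi hj hij
  have hfx : IsClosed {f x} := by simpa using f.isClosedMap _ hx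
  rw [← hP, hij] at hfx
  obtain ⟨g, hgP, hg⟩ := PrimeSpectrum.exists_mem_ne_zero hdimS hj _ hfx
  cases hl : l.length with
  | zero => omega
  | succ n =>
    rw [hl] at hn
    have heR : ringKrullDim Γ(S, U) ≤ e := by
      rw [← PrimeSpectrum.topologicalKrullDim_eq_ringKrullDim]
      exact hj.isInducing.topologicalKrullDim_le.trans he
    obtain ⟨a, b, ha, hb, hab⟩ := PrimeSpectrum.exists_ltSeries_not_specializes
      f.continuous f.isClosedMap φ.isClosedMap hinj θ hi hj hij P hn heR
      (by rwa [Ne, map_eq_zero_iff θ hθ]) hgP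
    by_contra hlt
    obtain ⟨w, hwa, hwb⟩ := ProjSpace.exists_specializes
      (φ.continuous.comp hi.continuous) (hinj.comp hi.injective) a b (by omega)
    exact hab w hwa hwb

/-- If `f : X ⟶ S` is a surjective morphism of irreducible projective (reduced,
proper over `ℂ`) varieties with `dim S ≥ 1`, then every morphism `X ⟶ ℙ^s` over `ℂ`
injective on points satisfies `s ≥ 2·dim X − dim S`. -/
theorem stmt10 (X S : Scheme) [IsReduced X] [IsReduced S]
    [IrreducibleSpace X] [IrreducibleSpace S]
    (sX : X ⟶ Spec (CommRingCat.of ℂ)) [IsProper sX]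
    (sS : S ⟶ Spec (CommRingCat.of ℂ)) [IsProper sS]
    (f : X ⟶ S) (hf : f ≫ sS = sX) (hsurj : Function.Surjective f.base)
    (hdimS : 1 ≤ topologicalKrullDim S)
    (s : ℕ) (φ : X ⟶ ProjSpace s) (hφ : φ ≫ ProjSpace.structMor s = sX)
    (hinj : Function.Injective φ.base) :
    topologicalKrullDim X + topologicalKrullDim X
      ≤ ((s : ℕ∞) : WithBot ℕ∞) + topologicalKrullDim S := by
  have key {e : ℕ} (he : topologicalKrullDim S ≤ e) (l : LTSeries (IrreducibleCloseds X)) :=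
    ProjSpace.length_add_length_le X S sX sS f hf hsurj hdimS s φ hφ hinj he l
  obtain ⟨d, hd⟩ : ∃ d : ℕ∞, topologicalKrullDim S = d :=
    ⟨_, (WithBot.coe_unbot _ (ne_bot_of_le_ne_bot (by simp) hdimS)).symm⟩
  rw [hd] at key ⊢
  induction d with
  | top =>
    rw [← WithBot.coe_add, add_top]
    exact le_top
  | coe e =>
    replace key := key (e := e) le_rfl
    have : Nonempty (IrreducibleCloseds X) :=
      ⟨⟨Set.univ, IrreducibleSpace.isIrreducible_univ X, isClosed_univ⟩⟩
    rcases finiteDimensionalOrder_or_infiniteDimensionalOrder (IrreducibleCloseds X) with h | h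
    · rw [topologicalKrullDim, Order.krullDim_eq_length_of_finiteDimensionalOrder]
      exact_mod_cast key _
    · have := key (LTSeries.withLength _ (s + e + 1))
      rw [LTSeries.length_withLength] at this
      omega
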